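/- Evaluation of the rate function J for the semicircle law at a BBP outlier: let a ≥ 1, γ = a + 1/a, and η > 0. If η ≥ 1/a then J(μ_SC, η, γ) = ηγ − 1/(2a²) − ln(ηa) − 1, while if 0 < η < 1/a then J(μ_SC, η, γ) = η²/2. -/

import Mathlib

open MeasureTheory Filter

noncomputable section

/-- The standard semicircle law: the probability measure on `[−2,2]` with density
`(2π)⁻¹ √(4 − x²)` with respect to Lebesgue measure. -/
def semicircle : Measure ℝ :=
  MeasureTheory.volume.withDensity fun x =>
    ENNReal.ofReal
      (Set.indicator (Set.Icc (-2 : ℝ) 2)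
        (fun x => 1 / (2 * Real.pi) * Real.sqrt (4 - x ^ 2)) x)

/-- The Stieltjes transform `H_μ(z) = ∫ (z − x)⁻¹ dμ(x)`. -/
def stieltjesT (μ : Measure ℝ) (z : ℝ) : ℝ := ∫ x, (z - x)⁻¹ ∂ μ

/-- The (topological) support of a measure on `ℝ`: points all of whose neighbourhoods
have positive measure. -/
def msupport (μ : Measure ℝ) : Set ℝ := {x | ∀ U ∈ nhds x, 0 < μ U}

/-- Functional inverse of the Stieltjes transform on the right of the support. -/
def stieltjesInv (μ : Measure ℝ) (η : ℝ) : ℝ :=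
  sInf {z : ℝ | sSup (msupport μ) < z ∧ stieltjesT μ z ≤ η}

/-- The optimizer `v(μ, η, γ)`. -/
def vOpt (μ : Measure ℝ) (η γ : ℝ) : ℝ :=
  if stieltjesT μ γ ≤ η then γ else stieltjesInv μ η

/-- `K(μ, η, γ, v) = ηγ + (v − γ)H_μ(v) − ∫ ln(η|v − x|) dμ(x) − 1`. -/
def Kfun (μ : Measure ℝ) (η γ v : ℝ) : ℝ :=
  η * γ + (v - γ) * stieltjesT μ v - (∫ x, Real.log (η * |v - x|) ∂ μ) - 1

/-- The rate function `J(μ, η, γ) = K(μ, η, γ, v(μ, η, γ))`, with `J(μ, 0, γ) = 0`. -/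
def Jfun (μ : Measure ℝ) (η γ : ℝ) : ℝ :=
  if η = 0 then 0 else Kfun μ η γ (vOpt μ η γ)

open Real Set in
theorem measurable_semicircle_density : Measurable fun x : ℝ => ENNReal.ofReal
    (indicator (Icc (-2 : ℝ) 2) (fun x => 1 / (2 * π) * √(4 - x ^ 2)) x) :=
  ENNReal.measurable_ofReal.comp (Measurable.indicator (by fun_prop) measurableSet_Icc)

open Real Set in
/-- Change of variables `x = 2 cos θ` in an integral against the semicircle law. -/
theorem integral_semicircle (g : ℝ → ℝ) :
    ∫ x, g x ∂semicircle = 2 / π * ∫ θ in (0)..π, g (2 * cos θ) * sin θ ^ 2 := by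
  have himg : (fun θ => 2 * cos θ) '' Icc 0 π = Icc (-2) 2 := by
    ext x
    constructor
    · rintro ⟨θ, -, rfl⟩
      exact ⟨by dsimp only; linarith [neg_one_le_cos θ], by dsimp only; linarith [cos_le_one θ]⟩
    · rintro ⟨h1, h2⟩
      refine ⟨arccos (x / 2), ⟨arccos_nonneg _, arccos_le_pi _⟩, ?_⟩
      dsimp only
      rw [cos_arccos (by linarith) (by linarith)]
      ring
  have hinj : InjOn (fun θ => 2 * cos θ) (Icc 0 π) := fun x hx y hy hxy =>
    injOn_cos hx hy (by dsimp only at hxy; linarith)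
  have hderiv : ∀ θ ∈ Icc 0 π, HasDerivWithinAt (fun θ => 2 * cos θ) (2 * -sin θ) (Icc 0 π) θ :=
    fun θ _ => ((hasDerivAt_cos θ).const_mul 2).hasDerivWithinAt
  have hstep : ∀ x, (ENNReal.ofReal
      (indicator (Icc (-2 : ℝ) 2) (fun x => 1 / (2 * π) * √(4 - x ^ 2)) x)).toReal • g x
      = indicator (Icc (-2 : ℝ) 2) (fun x => 1 / (2 * π) * √(4 - x ^ 2) * g x) x := by
    intro x
    rw [ENNReal.toReal_ofReal (indicator_nonneg (fun x _ => by positivity) x)]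
    by_cases hx : x ∈ Icc (-2 : ℝ) 2 <;> simp [hx]
  rw [semicircle,
    integral_withDensity_eq_integral_toReal_smul measurable_semicircle_density (by simp)]
  simp_rw [hstep]
  rw [integral_indicator measurableSet_Icc, ← himg,
    integral_image_eq_integral_abs_deriv_smul measurableSet_Icc hderiv hinj,
    intervalIntegral.integral_of_le pi_pos.le, ← integral_Icc_eq_integral_Ioc,
    ← integral_const_mul]
  refine setIntegral_congr_fun measurableSet_Icc fun θ hθ => ?_
  have hs : 0 ≤ sin θ := sin_nonneg_of_nonneg_of_le_pi hθ.1 hθ.2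
  have hsq : √(4 - (2 * cos θ) ^ 2) = 2 * sin θ := by
    rw [show 4 - (2 * cos θ) ^ 2 = (2 * sin θ) ^ 2 by nlinarith [sin_sq_add_cos_sq θ]]
    exact sqrt_sq (by positivity)
  have habs : |2 * -sin θ| = 2 * sin θ := by
    rw [mul_neg, abs_neg, abs_of_nonneg (by positivity)]
  simp only [hsq, habs, smul_eq_mul]
  field_simp

open Real Set in
theorem one_sub_two_mul_cos_add_sq_pos {r θ : ℝ} (hθ : θ ∈ Ioo 0 π) :
    0 < 1 - 2 * r * cos θ + r ^ 2 := by
  have := sin_pos_of_mem_Ioo hθ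
  nlinarith [sin_sq_add_cos_sq θ, sq_nonneg (r - cos θ), pow_pos this 2]

open Real Set in
theorem sin_sq_div_le_one (r θ : ℝ) :
    ‖sin θ ^ 2 / (1 - 2 * r * cos θ + r ^ 2)‖ ≤ 1 := by
  have h : sin θ ^ 2 ≤ 1 - 2 * r * cos θ + r ^ 2 := by
    nlinarith [sin_sq_add_cos_sq θ, sq_nonneg (r - cos θ)]
  rw [norm_eq_abs, abs_of_nonneg (div_nonneg (sq_nonneg _) ((sq_nonneg _).trans h))]
  exact div_le_one_of_le₀ h ((sq_nonneg _).trans h)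

open Real Set in
theorem intervalIntegrable_sin_sq_div (r a b : ℝ) :
    IntervalIntegrable (fun θ => sin θ ^ 2 / (1 - 2 * r * cos θ + r ^ 2)) volume a b :=
  (intervalIntegrable_const (c := (1 : ℝ))).mono_fun
    (Measurable.aestronglyMeasurable (by fun_prop))
    (.of_forall fun θ => by simpa using sin_sq_div_le_one r θ)

open Real Set in
theorem integral_sin_sq_zero_pi : ∫ θ in (0)..π, sin θ ^ 2 = π / 2 := by
  rw [integral_sin_sq]
  simp

open Real Set in
theorem integral_sin_sq_div {r : ℝ} (h0 : 0 < r) (h1 : r ≤ 1) :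
    ∫ θ in (0)..π, sin θ ^ 2 / (1 - 2 * r * cos θ + r ^ 2) = π / 2 := by
  rcases h1.lt_or_eq with h1 | rfl
  · have hpos : ∀ θ, 0 < 1 - r * cos θ := fun θ => by nlinarith [cos_le_one θ]
    have hD : ∀ θ, 0 < 1 - 2 * r * cos θ + r ^ 2 := fun θ => by
      nlinarith [cos_le_one θ, pow_pos (sub_pos.2 h1) 2]
    have key : ∀ θ ∈ uIcc 0 π, HasDerivAt (fun θ => sin θ / (2 * r)
        + (1 + r ^ 2) / (4 * r ^ 2) * θ
        - (1 - r ^ 2) / (4 * r ^ 2) * (θ + 2 * arctan (r * sin θ / (1 - r * cos θ))))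
        (sin θ ^ 2 / (1 - 2 * r * cos θ + r ^ 2)) θ := by
      intro θ _
      have hp := (hpos θ).ne'
      have hq : HasDerivAt (fun θ => r * sin θ / (1 - r * cos θ)) _ θ :=
        ((hasDerivAt_sin θ).const_mul r).div
          (((hasDerivAt_cos θ).const_mul r).const_sub 1) hp
      have := (((hasDerivAt_sin θ).div_const (2 * r)).add
        ((hasDerivAt_id θ).const_mul ((1 + r ^ 2) / (4 * r ^ 2)))).sub
        (((hasDerivAt_id θ).add (hq.arctan.const_mul 2)).const_mul ((1 - r ^ 2) / (4 * r ^ 2)))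
      refine this.congr_deriv ?_
      have hsc := sin_sq_add_cos_sq θ
      have hD' := (hD θ).ne'
      have hP : 1 / (1 + (r * sin θ / (1 - r * cos θ)) ^ 2) *
          ((r * cos θ * (1 - r * cos θ) - r * sin θ * -(r * -sin θ)) / (1 - r * cos θ) ^ 2)
          = (r * cos θ - r ^ 2) / (1 - 2 * r * cos θ + r ^ 2) := by
        have e : 1 + (r * sin θ / (1 - r * cos θ)) ^ 2
            = (1 - 2 * r * cos θ + r ^ 2) / (1 - r * cos θ) ^ 2 := by
          field_simp
          linear_combination r ^ 2 * hsc
        rw [e]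
        field_simp
        linear_combination (-r) * hsc
      rw [hP]
      generalize hDe : 1 - 2 * r * cos θ + r ^ 2 = D at hD' ⊢
      field_simp
      rw [← hDe, sin_sq]
      ring
    rw [intervalIntegral.integral_eq_sub_of_hasDerivAt key (intervalIntegrable_sin_sq_div r 0 π)]
    simp only [sin_pi, sin_zero, mul_zero, zero_div, arctan_zero]
    field_simp
    ring
  · have : ∫ θ in (0)..π, sin θ ^ 2 / (1 - 2 * 1 * cos θ + 1 ^ 2)
        = ∫ θ in (0)..π, (1 / 2 + 1 / 2 * cos θ) := by
      rw [intervalIntegral.integral_of_le pi_pos.le, intervalIntegral.integral_of_le pi_pos.le,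
        integral_Ioc_eq_integral_Ioo, integral_Ioc_eq_integral_Ioo]
      refine setIntegral_congr_fun measurableSet_Ioo fun θ hθ => ?_
      rw [div_eq_iff (one_sub_two_mul_cos_add_sq_pos hθ).ne', sin_sq]
      ring
    rw [this, intervalIntegral.integral_add (by simp) (by
      exact (continuous_const.mul continuous_cos).intervalIntegrable _ _)]
    simp
    ring

open Real Set in
theorem intervalIntegrable_sin_sq_mul_cos_div (r a b : ℝ) :
    IntervalIntegrable (fun θ => sin θ ^ 2 * cos θ / (1 - 2 * r * cos θ + r ^ 2)) volume a b :=
  ((intervalIntegrable_sin_sq_div r a b).mul_continuousOn continuous_cos.continuousOn).congr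
    (fun θ _ => by ring)

open Real Set in
theorem integral_sin_sq_mul_cos_div {r : ℝ} (h0 : 0 < r) (h1 : r ≤ 1) :
    ∫ θ in (0)..π, sin θ ^ 2 * cos θ / (1 - 2 * r * cos θ + r ^ 2) = π * r / 4 := by
  have : ∫ θ in (0)..π, sin θ ^ 2 * cos θ / (1 - 2 * r * cos θ + r ^ 2)
      = ∫ θ in (0)..π, ((1 + r ^ 2) / (2 * r) * (sin θ ^ 2 / (1 - 2 * r * cos θ + r ^ 2))
        - 1 / (2 * r) * sin θ ^ 2) := by
    rw [intervalIntegral.integral_of_le pi_pos.le, intervalIntegral.integral_of_le pi_pos.le,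
      integral_Ioc_eq_integral_Ioo, integral_Ioc_eq_integral_Ioo]
    refine setIntegral_congr_fun measurableSet_Ioo fun θ hθ => ?_
    have hD := (one_sub_two_mul_cos_add_sq_pos (r := r) hθ).ne'
    generalize hDe : 1 - 2 * r * cos θ + r ^ 2 = D at hD ⊢
    field_simp
    rw [← hDe]
    ring
  rw [this, intervalIntegral.integral_sub ((intervalIntegrable_sin_sq_div r 0 π).const_mul _)
    (Continuous.intervalIntegrable (by fun_prop) _ _), intervalIntegral.integral_const_mul,
    intervalIntegral.integral_const_mul, integral_sin_sq_div h0 h1, integral_sin_sq_zero_pi]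
  field_simp
  ring

open Real Set in
theorem log_norm_circleMap_sub (r θ : ℝ) :
    log ‖circleMap 0 1 θ - r‖ = 1 / 2 * log (1 - 2 * r * cos θ + r ^ 2) := by
  have h : ‖circleMap 0 1 θ - r‖ = √(1 - 2 * r * cos θ + r ^ 2) := by
    rw [Complex.norm_def, Complex.normSq_apply]
    congr 1
    simp [circleMap, Complex.exp_ofReal_mul_I_re, Complex.exp_ofReal_mul_I_im]
    linear_combination sin_sq_add_cos_sq θ
  have hD : 0 ≤ 1 - 2 * r * cos θ + r ^ 2 := by
    nlinarith [sin_sq_add_cos_sq θ, sq_nonneg (r - cos θ), sq_nonneg (sin θ)]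
  rw [h, log_sqrt hD]
  ring

open Real Set in
theorem intervalIntegrable_log_one_sub_two_mul_cos (r : ℝ) :
    IntervalIntegrable (fun θ => log (1 - 2 * r * cos θ + r ^ 2)) volume 0 (2 * π) := by
  have := (circleIntegrable_log_norm_sub_const (a := (r : ℂ)) (c := 0) 1)
  unfold CircleIntegrable at this
  simp only [log_norm_circleMap_sub] at this
  refine (this.const_mul 2).congr (fun θ _ => by ring)

open Real Set in
theorem intervalIntegrable_log_zero_pi (r : ℝ) :
    IntervalIntegrable (fun θ => log (1 - 2 * r * cos θ + r ^ 2)) volume 0 π :=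
  (intervalIntegrable_log_one_sub_two_mul_cos r).mono_set
    (by rw [uIcc_of_le pi_pos.le, uIcc_of_le (by positivity)]
        exact Icc_subset_Icc_right (by linarith [pi_pos]))

open Real Set in
/-- Jensen's formula for `z - r` with `|r| ≤ 1`, folded to a half circle. -/
theorem integral_log_one_sub_two_mul_cos {r : ℝ} (hr : |r| ≤ 1) :
    ∫ θ in (0)..π, log (1 - 2 * r * cos θ + r ^ 2) = 0 := by
  have hfull : ∫ θ in (0)..(2 * π), log (1 - 2 * r * cos θ + r ^ 2) = 0 := by
    have h := circleAverage_log_norm_sub_const_eq_posLog (a := (r : ℂ))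
    rw [circleAverage_def, posLog_eq_zero_iff _ |>.2 (by simpa using hr)] at h
    simp only [log_norm_circleMap_sub, intervalIntegral.integral_const_mul, smul_eq_mul] at h
    have := pi_pos.ne'
    simpa [this] using h
  have hi := intervalIntegrable_log_zero_pi r
  have hrefl : ∫ θ in π..(2 * π), log (1 - 2 * r * cos θ + r ^ 2)
      = ∫ θ in (0)..π, log (1 - 2 * r * cos θ + r ^ 2) := by
    have := intervalIntegral.integral_comp_sub_left
      (fun θ => log (1 - 2 * r * cos θ + r ^ 2)) (a := 0) (b := π) (2 * π)
    simp only [cos_two_pi_sub, sub_zero] at this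
    rw [this]
    congr 1
    ring
  have hi2 : IntervalIntegrable (fun θ => log (1 - 2 * r * cos θ + r ^ 2)) volume π (2 * π) :=
    (intervalIntegrable_log_one_sub_two_mul_cos r).mono_set
      (by rw [uIcc_of_le (by linarith [pi_pos]), uIcc_of_le (by positivity)]
          exact Icc_subset_Icc_left pi_pos.le)
  have hadd := intervalIntegral.integral_add_adjacent_intervals hi hi2
  linarith

open Real Set in
theorem continuousOn_log_mul_sin_two_mul {r : ℝ} (h0 : 0 < r) (h1 : r ≤ 1) :
    ContinuousOn (fun θ => log (1 - 2 * r * cos θ + r ^ 2) * (sin (2 * θ) / 2)) (Icc 0 π) := by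
  rcases h1.lt_or_eq with h1 | rfl
  · refine Continuous.continuousOn (.mul (.log (by fun_prop) fun θ => ?_) (by fun_prop))
    nlinarith [cos_le_one θ, pow_pos (sub_pos.2 h1) 2]
  · have hc : Continuous fun θ : ℝ =>
        2 * cos (θ / 2) * cos θ * (2 * sin (θ / 2) * log (2 * sin (θ / 2))) :=
      .mul (by fun_prop) (continuous_mul_log.comp (by fun_prop : Continuous fun θ : ℝ =>
        2 * sin (θ / 2)))
    refine hc.continuousOn.congr fun θ _ => ?_
    have e : 1 - 2 * 1 * cos θ + 1 ^ 2 = (2 * sin (θ / 2)) ^ 2 := by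
      have := cos_two_mul (θ / 2)
      rw [mul_div_cancel₀ θ two_ne_zero] at this
      have := sin_sq_add_cos_sq (θ / 2)
      linarith
    have e2 : sin θ = 2 * sin (θ / 2) * cos (θ / 2) := by
      rw [← sin_two_mul]
      ring_nf
    simp only [e, log_pow, sin_two_mul, e2]
    push_cast
    ring

open Real Set in
theorem integral_log_mul_cos_two_mul {r : ℝ} (h0 : 0 < r) (h1 : r ≤ 1) :
    ∫ θ in (0)..π, log (1 - 2 * r * cos θ + r ^ 2) * cos (2 * θ) = -(π * r ^ 2 / 2) := by
  have hi1 := (intervalIntegrable_log_zero_pi r).mul_continuousOn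
    (g := fun θ => cos (2 * θ)) (by fun_prop)
  have hi2 := (intervalIntegrable_sin_sq_mul_cos_div r 0 π).const_mul (2 * r)
  have key : ∀ θ ∈ Ioo 0 π, HasDerivAt
      (fun θ => log (1 - 2 * r * cos θ + r ^ 2) * (sin (2 * θ) / 2))
      (log (1 - 2 * r * cos θ + r ^ 2) * cos (2 * θ)
        + 2 * r * (sin θ ^ 2 * cos θ / (1 - 2 * r * cos θ + r ^ 2))) θ := by
    intro θ hθ
    have hD := (one_sub_two_mul_cos_add_sq_pos (r := r) hθ).ne'
    have hl := ((((hasDerivAt_cos θ).const_mul (2 * r)).const_sub 1).add_const (r ^ 2)).log hD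
    have hs := (((hasDerivAt_id θ).const_mul 2).sin).div_const 2
    refine (hl.mul hs).congr_deriv ?_
    simp only [id, sin_two_mul]
    field_simp
    ring
  have h := intervalIntegral.integral_eq_sub_of_hasDerivAt_of_le pi_pos.le
    (continuousOn_log_mul_sin_two_mul h0 h1) key (hi1.add hi2)
  rw [intervalIntegral.integral_add hi1 hi2, intervalIntegral.integral_const_mul,
    integral_sin_sq_mul_cos_div h0 h1] at h
  simp only [sin_two_pi, mul_zero, sin_zero, zero_div, sub_zero] at h
  linear_combination h

open Real Set in
theorem integral_log_mul_sin_sq {r : ℝ} (h0 : 0 < r) (h1 : r ≤ 1) :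
    ∫ θ in (0)..π, log (1 - 2 * r * cos θ + r ^ 2) * sin θ ^ 2 = π * r ^ 2 / 4 := by
  have hi := intervalIntegrable_log_zero_pi r
  have hi1 := hi.mul_continuousOn (g := fun θ => cos (2 * θ)) (by fun_prop)
  have e : ∀ θ, log (1 - 2 * r * cos θ + r ^ 2) * sin θ ^ 2
      = 1 / 2 * log (1 - 2 * r * cos θ + r ^ 2)
        - 1 / 2 * (log (1 - 2 * r * cos θ + r ^ 2) * cos (2 * θ)) := fun θ => by
    rw [cos_two_mul, sin_sq]
    ring
  simp_rw [e]
  rw [intervalIntegral.integral_sub (hi.const_mul _) (hi1.const_mul _),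
    intervalIntegral.integral_const_mul, intervalIntegral.integral_const_mul,
    integral_log_mul_cos_two_mul h0 h1,
    integral_log_one_sub_two_mul_cos (abs_le.2 ⟨by linarith, h1⟩)]
  ring

/-- On `[2, ∞)`, parametrized as `b + 1 / b` with `b ≥ 1`, the Stieltjes transform of the
semicircle law is `1 / b`. -/
theorem stieltjesT_semicircle {b : ℝ} (hb : 1 ≤ b) :
    stieltjesT semicircle (b + 1 / b) = 1 / b := by
  have hb0 : 0 < b := by linarith
  rw [stieltjesT, integral_semicircle]
  have e : ∀ θ : ℝ, (b + 1 / b - 2 * Real.cos θ)⁻¹ * Real.sin θ ^ 2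
      = 1 / b * (Real.sin θ ^ 2 / (1 - 2 * (1 / b) * Real.cos θ + (1 / b) ^ 2)) := fun θ => by
    rw [show b + 1 / b - 2 * Real.cos θ
      = b * (1 - 2 * (1 / b) * Real.cos θ + (1 / b) ^ 2) by field_simp; ring, mul_inv]
    ring
  simp_rw [e]
  rw [intervalIntegral.integral_const_mul,
    integral_sin_sq_div (by positivity) ((div_le_one hb0).2 hb)]
  field_simp [Real.pi_pos.ne']

open Real Set in
/-- The logarithmic potential of the semicircle law at `b + 1 / b` with `b ≥ 1`. -/
theorem integral_log_semicircle {b η : ℝ} (hb : 1 ≤ b) (hη : 0 < η) :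
    ∫ x, log (η * |b + 1 / b - x|) ∂semicircle = log (η * b) + 1 / (2 * b ^ 2) := by
  have hb0 : 0 < b := by linarith
  rw [integral_semicircle]
  have e : ∫ θ in (0)..π, log (η * |b + 1 / b - 2 * cos θ|) * sin θ ^ 2
      = ∫ θ in (0)..π, (log (η * b) * sin θ ^ 2
        + log (1 - 2 * (1 / b) * cos θ + (1 / b) ^ 2) * sin θ ^ 2) := by
    rw [intervalIntegral.integral_of_le pi_pos.le, intervalIntegral.integral_of_le pi_pos.le,
      integral_Ioc_eq_integral_Ioo, integral_Ioc_eq_integral_Ioo]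
    refine setIntegral_congr_fun measurableSet_Ioo fun θ hθ => ?_
    have hD := one_sub_two_mul_cos_add_sq_pos (r := 1 / b) hθ
    rw [show b + 1 / b - 2 * cos θ
      = b * (1 - 2 * (1 / b) * cos θ + (1 / b) ^ 2) by field_simp; ring,
      abs_of_pos (by positivity), ← mul_assoc, log_mul (by positivity) hD.ne']
    ring
  rw [e, intervalIntegral.integral_add (Continuous.intervalIntegrable (by fun_prop) _ _)
    ((intervalIntegrable_log_zero_pi _).mul_continuousOn (by fun_prop)),
    intervalIntegral.integral_const_mul, integral_sin_sq_zero_pi,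
    integral_log_mul_sin_sq (by positivity) ((div_le_one hb0).2 hb)]
  field_simp
  ring

open Real Set in
theorem isGreatest_msupport_semicircle : IsGreatest (msupport semicircle) 2 := by
  constructor
  · intro U hU
    obtain ⟨ε, hε, hball⟩ := Metric.mem_nhds_iff.1 hU
    rw [pos_iff_ne_zero, semicircle, Ne, withDensity_apply_eq_zero measurable_semicircle_density]
    intro h0
    have hsub : Ioo (max (2 - ε) 0) 2 ⊆ {x | ENNReal.ofReal
        (indicator (Icc (-2 : ℝ) 2) (fun x => 1 / (2 * π) * √(4 - x ^ 2)) x) ≠ 0} ∩ U := by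
      rintro x ⟨hx1, hx2⟩
      obtain ⟨hx1, hx3⟩ := max_lt_iff.1 hx1
      refine ⟨?_, hball ?_⟩
      · have : 0 < 4 - x ^ 2 := by nlinarith
        rw [mem_ofPred_eq, indicator_of_mem (by constructor <;> linarith), ne_eq,
          ENNReal.ofReal_eq_zero, not_le]
        positivity
      · rw [Metric.mem_ball, dist_eq, abs_lt]
        constructor <;> linarith
    have := measure_mono_null hsub h0
    rw [Real.volume_Ioo, ENNReal.ofReal_eq_zero] at this
    have : max (2 - ε) 0 < 2 := max_lt (by linarith) (by norm_num)
    linarith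
  · intro x hx
    by_contra! hlt
    refine (hx (Ioi 2) (Ioi_mem_nhds hlt)).ne' ?_
    rw [semicircle, withDensity_apply_eq_zero measurable_semicircle_density]
    convert measure_empty (μ := volume)
    ext y
    simp only [mem_inter_iff, mem_ofPred_eq, mem_Ioi, mem_empty_iff_false, iff_false, not_and]
    intro hy hy2
    exact hy (by rw [indicator_of_notMem fun h => by linarith [h.2], ENNReal.ofReal_zero])

theorem exists_eq_add_one_div {z : ℝ} (hz : 2 < z) : ∃ b : ℝ, 1 < b ∧ z = b + 1 / b := by
  have h : 0 < z ^ 2 - 4 := by nlinarith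
  have hs := Real.sq_sqrt h.le
  have hs0 := Real.sqrt_pos.2 h
  refine ⟨(z + √(z ^ 2 - 4)) / 2, by linarith, ?_⟩
  have : z + √(z ^ 2 - 4) ≠ 0 := by linarith
  field_simp
  linarith

theorem stieltjesInv_semicircle {η : ℝ} (h0 : 0 < η) (h1 : η < 1) :
    stieltjesInv semicircle η = η + 1 / η := by
  have hset : {z : ℝ | sSup (msupport semicircle) < z ∧ stieltjesT semicircle z ≤ η}
      = Set.Ici (η + 1 / η) := by
    rw [isGreatest_msupport_semicircle.csSup_eq]
    have hη2 : 2 < η + 1 / η := by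
      rw [← sub_pos, show η + 1 / η - 2 = (1 - η) ^ 2 / η by field_simp; ring]
      have := sub_pos.2 h1
      positivity
    have hcmp : ∀ b : ℝ, 1 < b → (1 / b ≤ η ↔ η + 1 / η ≤ b + 1 / b) := by
      intro b hb
      have hb0 : 0 < b := by linarith
      have e : b + 1 / b - (η + 1 / η) = (b * η - 1) * (b - η) / (b * η) := by
        field_simp
        ring
      rw [div_le_iff₀ hb0, ← sub_nonneg (a := b + 1 / b), e,
        le_div_iff₀ (mul_pos hb0 h0), zero_mul, mul_nonneg_iff_of_pos_right (by linarith),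
        sub_nonneg, mul_comm]
    ext z
    simp only [Set.mem_ofPred_eq, Set.mem_Ici]
    constructor
    · rintro ⟨hz, hH⟩
      obtain ⟨b, hb, rfl⟩ := exists_eq_add_one_div hz
      rw [stieltjesT_semicircle hb.le] at hH
      exact (hcmp b hb).1 hH
    · intro hz
      have hz2 : 2 < z := hη2.trans_le hz
      obtain ⟨b, hb, rfl⟩ := exists_eq_add_one_div hz2
      rw [stieltjesT_semicircle hb.le]
      exact ⟨hz2, (hcmp b hb).2 hz⟩
  rw [stieltjesInv, hset, csInf_Ici]

/-- **Evaluation of the rate function `J` for the semicircle law at a BBP outlier.**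
Let `a ≥ 1`, `γ = a + 1/a` and `η > 0`.  If `η ≥ 1/a` then
`J(μ_SC, η, γ) = ηγ − 1/(2a²) − ln(ηa) − 1`, while if `0 < η < 1/a` then
`J(μ_SC, η, γ) = η²/2`. -/
theorem semicircle_J_eval (a η : ℝ) (ha : 1 ≤ a) (hη : 0 < η) :
    (1 / a ≤ η →
      Jfun semicircle η (a + 1 / a)
        = η * (a + 1 / a) - 1 / (2 * a ^ 2) - Real.log (η * a) - 1)
    ∧ (η < 1 / a → Jfun semicircle η (a + 1 / a) = η ^ 2 / 2) := by
  have ha0 : 0 < a := by linarith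
  constructor
  · intro h
    rw [Jfun, if_neg hη.ne', vOpt, stieltjesT_semicircle ha, if_pos h, Kfun,
      integral_log_semicircle ha hη]
    ring
  · intro h
    have h1 : η < 1 := h.trans_le ((div_le_one ha0).2 ha)
    have hb : 1 ≤ 1 / η := (one_le_div hη).2 h1.le
    have hv : η + 1 / η = 1 / η + 1 / (1 / η) := by rw [one_div_one_div, add_comm]
    rw [Jfun, if_neg hη.ne', vOpt, stieltjesT_semicircle ha, if_neg h.not_ge,
      stieltjesInv_semicircle hη h1, Kfun, hv, stieltjesT_semicircle hb,
      integral_log_semicircle hb hη, mul_one_div_cancel hη.ne', Real.log_one]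
    field_simp
    ring

end
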